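/- Let R = I₁ × I₂ ⊂ ℝ^{n₁} × ℝ^{n₂} be a rectangle that is a product of two cubes with sides parallel to the coordinate axes, and let f ∈ C²(R). Then there is a constant c depending only on n₁ and n₂ such that ∫_R |f − π_R(f)| dx dy ≤ c · ℓ(I₁) ℓ(I₂) ∫_R |∇_x∇_y f| dx dy. -/

import Mathlib

noncomputable section
open MeasureTheory ENNReal Set

abbrev E (m : ℕ) : Type := EuclideanSpace ℝ (Fin m)

/-- Axis-parallel cube in `ℝ^m` with corner `a` and side length `r`. -/
def cube {m : ℕ} (a : E m) (r : ℝ) : Set (E m) :=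
  {x | ∀ i, x i ∈ Set.Icc (a i) (a i + r)}

/-- Rectangle `I₁ × I₂`, a product of two axis-parallel cubes. -/
def rect {n₁ n₂ : ℕ} (a₁ : E n₁) (r₁ : ℝ) (a₂ : E n₂) (r₂ : ℝ) : Set (E n₁ × E n₂) :=
  (cube a₁ r₁) ×ˢ (cube a₂ r₂)

/-- `K` is an admissible `A_{p,ℛ}` constant for `w` (`p > 1`). -/
def rectApBound (n₁ n₂ : ℕ) (p K : ℝ) (w : E n₁ × E n₂ → ℝ) : Prop :=
  ∀ (a₁ : E n₁) (r₁ : ℝ) (a₂ : E n₂) (r₂ : ℝ), 0 < r₁ → 0 < r₂ →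
    ((∫⁻ z in rect a₁ r₁ a₂ r₂, ENNReal.ofReal (w z)) / volume (rect a₁ r₁ a₂ r₂)) *
      (((∫⁻ z in rect a₁ r₁ a₂ r₂, ENNReal.ofReal (w z ^ (-1 / (p - 1)))) /
        volume (rect a₁ r₁ a₂ r₂)) ^ (p - 1)) ≤ ENNReal.ofReal K

/-- `K` is an admissible `A_{1,ℛ}` constant for `w`. -/
def rectA1Bound (n₁ n₂ : ℕ) (K : ℝ) (w : E n₁ × E n₂ → ℝ) : Prop :=
  ∀ (a₁ : E n₁) (r₁ : ℝ) (a₂ : E n₂) (r₂ : ℝ), 0 < r₁ → 0 < r₂ →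
    (∫⁻ z in rect a₁ r₁ a₂ r₂, ENNReal.ofReal (w z)) / volume (rect a₁ r₁ a₂ r₂)
      ≤ ENNReal.ofReal K *
        essInf (fun z => ENNReal.ofReal (w z)) (volume.restrict (rect a₁ r₁ a₂ r₂))

/-- The non-standard average `π_{I₁×I₂}(f)(x,y) = f_{I₁}^y + f_{I₂}^x - f_{I₁×I₂}`. -/
def piR {n₁ n₂ : ℕ} (a₁ : E n₁) (r₁ : ℝ) (a₂ : E n₂) (r₂ : ℝ)
    (f : E n₁ × E n₂ → ℝ) (z : E n₁ × E n₂) : ℝ :=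
  (⨍ x in cube a₁ r₁, f (x, z.2)) + (⨍ y in cube a₂ r₂, f (z.1, y)) -
    ⨍ u in rect a₁ r₁ a₂ r₂, f u

/-- Mixed second partial `∂²f/∂xᵢ∂yⱼ`. -/
def mixedPartial {n₁ n₂ : ℕ} (f : E n₁ × E n₂ → ℝ) (i : Fin n₁) (j : Fin n₂)
    (z : E n₁ × E n₂) : ℝ :=
  fderiv ℝ (fun x => fderiv ℝ (fun y => f (x, y)) z.2 (EuclideanSpace.single j (1:ℝ))) z.1
    (EuclideanSpace.single i (1:ℝ))

/-- Hilbert–Schmidt norm `|∇ₓ∇_y f|` of the mixed-derivative matrix. -/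
def mixedGradNorm {n₁ n₂ : ℕ} (f : E n₁ × E n₂ → ℝ) (z : E n₁ × E n₂) : ℝ :=
  Real.sqrt (∑ i : Fin n₁, ∑ j : Fin n₂, (mixedPartial f i j z) ^ 2)

/-- Weighted `L^p` "norm" on a set, as an extended nonnegative real. -/
def lpW {α : Type*} [MeasureSpace α] (p : ℝ) (A : Set α) (w : α → ℝ) (g : α → ℝ) : ℝ≥0∞ :=
  (∫⁻ z in A, ENNReal.ofReal |g z| ^ p * ENNReal.ofReal (w z)) ^ (1 / p)

/-- A contraction by a factor at least `1/2` increases integrals by a factor at most `2 ^ m`. -/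
lemma lintegral_comp_smul_add_le {m : ℕ} {h : E m → ℝ≥0∞} (hh : Measurable h) {s : ℝ}
    (hs : 1 / 2 ≤ s) (b : E m) :
    ∫⁻ x, h (s • x + b) ≤ 2 ^ m * ∫⁻ x, h x := by
  have hs0 : 0 < s := by linarith
  calc ∫⁻ x, h (s • x + b) = ∫⁻ x, h (x + b) ∂(Measure.map (s • ·) volume) := by
        rw [lintegral_map (by fun_prop) (by fun_prop)]
    _ = ENNReal.ofReal (|(s ^ m)⁻¹|) * ∫⁻ x, h x := by
        rw [Measure.map_addHaar_smul _ hs0.ne', lintegral_smul_measure, smul_eq_mul,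
          lintegral_add_right_eq_self h b, finrank_euclideanSpace_fin]
    _ ≤ 2 ^ m * ∫⁻ x, h x := by
        gcongr
        rw [show (2 : ℝ≥0∞) ^ m = ENNReal.ofReal (2 ^ m) by
          rw [ENNReal.ofReal_pow (by norm_num)]; simp]
        apply ENNReal.ofReal_le_ofReal
        rw [abs_of_pos (by positivity), ← inv_pow]
        gcongr
        rw [inv_le_comm₀ hs0 (by norm_num)]
        linarith

lemma setLIntegral_comp_convexComb_le_of_half_le {m : ℕ} {h : E m → ℝ≥0∞} (hh : Measurable h)
    {Q : Set (E m)} (hQ : MeasurableSet Q) (hc : Convex ℝ Q) {s : ℝ}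
    (hs : 1 / 2 ≤ s) (hs1 : s ≤ 1) {x' : E m} (hx' : x' ∈ Q) :
    ∫⁻ x in Q, h (x' + s • (x - x')) ≤ 2 ^ m * ∫⁻ x in Q, h x := by
  have e : ∀ x, x' + s • (x - x') = s • x + (1 - s) • x' := fun x => by module
  simp_rw [e]
  rw [← lintegral_indicator hQ, ← lintegral_indicator hQ]
  refine le_trans (lintegral_mono fun x => ?_)
    (lintegral_comp_smul_add_le (hh.indicator hQ) hs ((1 - s) • x'))
  by_cases hx : x ∈ Q
  · have : s • x + (1 - s) • x' ∈ Q := hc hx hx' (by linarith) (by linarith) (by ring)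
    simp [hx, this]
  · simp [hx]

lemma lintegral_lintegral_comp_convexComb_le {m : ℕ} {h : E m → ℝ≥0∞} (hh : Measurable h)
    {Q : Set (E m)} (hQ : MeasurableSet Q) (hc : Convex ℝ Q) {s : ℝ}
    (hs0 : 0 ≤ s) (hs1 : s ≤ 1) :
    ∫⁻ x in Q, ∫⁻ x' in Q, h (x' + s • (x - x')) ≤ 2 ^ m * volume Q * ∫⁻ x in Q, h x := by
  have key : ∀ t : ℝ, 1 / 2 ≤ t → t ≤ 1 →
      ∫⁻ x' in Q, ∫⁻ x in Q, h (x' + t • (x - x')) ≤ 2 ^ m * volume Q * ∫⁻ x in Q, h x := by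
    intro t ht ht1
    calc ∫⁻ x' in Q, ∫⁻ x in Q, h (x' + t • (x - x'))
        ≤ ∫⁻ _ in Q, 2 ^ m * ∫⁻ x in Q, h x :=
          setLIntegral_mono measurable_const fun x' hx' =>
            setLIntegral_comp_convexComb_le_of_half_le hh hQ hc ht ht1 hx'
      _ = 2 ^ m * volume Q * ∫⁻ x in Q, h x := by
          rw [setLIntegral_const]; ring
  rcases le_total (1 / 2) s with hs | hs
  · rw [lintegral_lintegral_swap]
    · exact key s hs hs1
    · exact (hh.comp (by fun_prop)).aemeasurable
  · have e : ∀ x x' : E m, x' + s • (x - x') = x + (1 - s) • (x' - x) := fun x x' => by module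
    simp_rw [e]
    exact key (1 - s) (by linarith) (by linarith)

lemma lintegral_rect_comp_convexComb_le {n₁ n₂ : ℕ} {h : E n₁ × E n₂ → ℝ≥0∞} (hh : Measurable h)
    {P : Set (E n₁)} {Q : Set (E n₂)} (hP : MeasurableSet P) (hPc : Convex ℝ P)
    (hQ : MeasurableSet Q) (hQc : Convex ℝ Q) {s t : ℝ}
    (hs0 : 0 ≤ s) (hs1 : s ≤ 1) (ht0 : 0 ≤ t) (ht1 : t ≤ 1) :
    ∫⁻ z in P ×ˢ Q, ∫⁻ w in P ×ˢ Q, h (w.1 + s • (z.1 - w.1), w.2 + t • (z.2 - w.2)) ≤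
      2 ^ (n₁ + n₂) * volume (P ×ˢ Q) * ∫⁻ z in P ×ˢ Q, h z := by
  have hm : Measurable fun q : (E n₁ × E n₂) × E n₁ × E n₂ =>
      h (q.2.1 + s • (q.1.1 - q.2.1), q.2.2 + t • (q.1.2 - q.2.2)) := hh.comp (by fun_prop)
  simp only [Measure.volume_eq_prod, ← Measure.prod_restrict]
  rw [lintegral_prod _ (Measurable.lintegral_prod_right' hm).aemeasurable,
    lintegral_prod _ hh.aemeasurable, Measure.prod_prod]
  calc ∫⁻ x in P, ∫⁻ y in Q, ∫⁻ w, h (w.1 + s • (x - w.1), w.2 + t • (y - w.2))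
          ∂((volume.restrict P).prod (volume.restrict Q))
      = ∫⁻ x in P, ∫⁻ x' in P, ∫⁻ y in Q, ∫⁻ y' in Q,
          h (x' + s • (x - x'), y' + t • (y - y')) := by
        refine lintegral_congr fun x => ?_
        rw [lintegral_lintegral_swap]
        · rw [lintegral_prod]
          · refine lintegral_congr fun x' => ?_
            rw [lintegral_lintegral_swap]
            exact (hh.comp (by fun_prop)).aemeasurable
          · refine (Measurable.lintegral_prod_right' (f := fun q : (E n₁ × E n₂) × E n₂ =>
              h (q.1.1 + s • (x - q.1.1), q.1.2 + t • (q.2 - q.1.2))) ?_).aemeasurable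
            exact hh.comp (by fun_prop)
        · exact (hh.comp (by fun_prop)).aemeasurable
    _ ≤ ∫⁻ x in P, ∫⁻ x' in P, 2 ^ n₂ * volume Q * ∫⁻ y in Q, h (x' + s • (x - x'), y) := by
        refine lintegral_mono fun x => lintegral_mono fun x' => ?_
        exact lintegral_lintegral_comp_convexComb_le
          (h := fun y => h (x' + s • (x - x'), y)) (hh.comp (by fun_prop)) hQ hQc ht0 ht1
    _ ≤ 2 ^ n₁ * volume P * ∫⁻ x in P, 2 ^ n₂ * volume Q * ∫⁻ y in Q, h (x, y) := by
        refine lintegral_lintegral_comp_convexComb_le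
          (h := fun x => 2 ^ n₂ * volume Q * ∫⁻ y in Q, h (x, y)) ?_ hP hPc hs0 hs1
        exact (Measurable.lintegral_prod_right' hh).const_mul _
    _ = 2 ^ (n₁ + n₂) * (volume P * volume Q) * ∫⁻ x in P, ∫⁻ y in Q, h (x, y) := by
        rw [lintegral_const_mul _ (Measurable.lintegral_prod_right' hh)]
        ring

lemma lintegral_lintegral_lintegral_comm {α β γ : Type*} [MeasurableSpace α] [MeasurableSpace β]
    [MeasurableSpace γ] {μ : Measure α} {ν : Measure β} {ρ : Measure γ} [SFinite μ] [SFinite ν]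
    [SFinite ρ] {F : α → β → γ → ℝ≥0∞}
    (hF : Measurable fun q : (α × β) × γ => F q.1.1 q.1.2 q.2) :
    ∫⁻ a, (∫⁻ b, (∫⁻ c, F a b c ∂ρ) ∂ν) ∂μ = ∫⁻ b, (∫⁻ c, (∫⁻ a, F a b c ∂μ) ∂ρ) ∂ν := by
  rw [lintegral_lintegral_swap (Measurable.lintegral_prod_right' hF).aemeasurable]
  refine lintegral_congr fun b => lintegral_lintegral_swap ?_
  exact (hF.comp (g := fun q : (α × β) × γ => F q.1.1 q.1.2 q.2)
    (f := fun q : α × γ => ((q.1, b), q.2)) (by fun_prop)).aemeasurable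

section Derivatives

variable {n₁ n₂ : ℕ} {f : E n₁ × E n₂ → ℝ}

lemma fderiv_partial_snd (hf : ContDiff ℝ 2 f) (x : E n₁) (y v : E n₂) :
    fderiv ℝ (fun y => f (x, y)) y v = fderiv ℝ f (x, y) (0, v) := by
  have h1 : HasFDerivAt f (fderiv ℝ f (x, y)) (x, y) :=
    (hf.differentiable (by norm_num) _).hasFDerivAt
  have h2 := h1.comp y (hasFDerivAt_prodMk_right (𝕜 := ℝ) x y)
  change HasFDerivAt (fun y => f (x, y)) _ y at h2
  rw [h2.fderiv]
  simp

lemma mixedPartial_eq (hf : ContDiff ℝ 2 f) (i : Fin n₁) (j : Fin n₂) (z : E n₁ × E n₂) :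
    mixedPartial f i j z = fderiv ℝ (fderiv ℝ f) z (EuclideanSpace.single i 1, 0)
      (0, EuclideanSpace.single j 1) := by
  unfold mixedPartial
  simp_rw [fderiv_partial_snd hf]
  have h1 : HasFDerivAt (fderiv ℝ f) (fderiv ℝ (fderiv ℝ f) z) (z.1, z.2) :=
    ((hf.fderiv_right (m := 1) (by norm_num)).differentiable (by norm_num) z).hasFDerivAt
  have h2 := (h1.comp z.1 (hasFDerivAt_prodMk_left (𝕜 := ℝ) z.1 z.2)).clm_apply
    (hasFDerivAt_const ((0 : E n₁), EuclideanSpace.single j (1 : ℝ)) z.1)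
  change HasFDerivAt (fun x => fderiv ℝ f (x, z.2) (0, EuclideanSpace.single j (1 : ℝ))) _ z.1 at h2
  rw [h2.fderiv]
  simp

lemma continuous_mixedGradNorm (hf : ContDiff ℝ 2 f) : Continuous (mixedGradNorm f) := by
  unfold mixedGradNorm
  simp_rw [mixedPartial_eq hf]
  have : Continuous (fderiv ℝ (fderiv ℝ f)) :=
    (hf.fderiv_right (m := 1) (by norm_num)).continuous_fderiv (by norm_num)
  fun_prop

lemma abs_mixedPartial_le (i : Fin n₁) (j : Fin n₂) (z : E n₁ × E n₂) :
    |mixedPartial f i j z| ≤ mixedGradNorm f z := by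
  apply Real.abs_le_sqrt
  refine le_trans ?_ (Finset.single_le_sum
    (f := fun i => ∑ j, (mixedPartial f i j z) ^ 2) (fun i _ => by positivity) (Finset.mem_univ i))
  exact Finset.single_le_sum
    (f := fun j => (mixedPartial f i j z) ^ 2) (fun j _ => by positivity) (Finset.mem_univ j)

lemma eq_sum_smul_single {m : ℕ} (u : E m) :
    u = ∑ i, u i • (EuclideanSpace.single i (1 : ℝ) : E m) := by
  simpa using ((EuclideanSpace.basisFun (Fin m) ℝ).sum_repr u).symm

lemma abs_fderiv_fderiv_le (hf : ContDiff ℝ 2 f) (z : E n₁ × E n₂) {u : E n₁} {v : E n₂}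
    {r₁ r₂ : ℝ} (hu : ∀ i, |u i| ≤ r₁) (hv : ∀ j, |v j| ≤ r₂) (hr₁ : 0 ≤ r₁) :
    |fderiv ℝ (fderiv ℝ f) z (u, 0) (0, v)| ≤ n₁ * n₂ * r₁ * r₂ * mixedGradNorm f z := by
  have e : fderiv ℝ (fderiv ℝ f) z (u, 0) (0, v) =
      ∑ i, ∑ j, u i * v j * mixedPartial f i j z := by
    have hu' : ((u, 0) : E n₁ × E n₂) =
        ∑ i, u i • ((EuclideanSpace.single i (1 : ℝ), 0) : E n₁ × E n₂) := by
      ext1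
      · simpa [Prod.fst_sum] using eq_sum_smul_single u
      · simp [Prod.snd_sum]
    have hv' : ((0, v) : E n₁ × E n₂) =
        ∑ i, v i • ((0, EuclideanSpace.single i (1 : ℝ)) : E n₁ × E n₂) := by
      ext1
      · simp [Prod.fst_sum]
      · simpa [Prod.snd_sum] using eq_sum_smul_single v
    rw [hu', hv']
    simp only [map_sum, map_smul, sum_apply, smul_apply,
      smul_eq_mul, Finset.mul_sum, mixedPartial_eq hf]
    rw [Finset.sum_comm]
    refine Finset.sum_congr rfl fun i _ => Finset.sum_congr rfl fun j _ => by ring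
  rw [e]
  calc |∑ i, ∑ j, u i * v j * mixedPartial f i j z|
      ≤ ∑ i, ∑ j, |u i * v j * mixedPartial f i j z| :=
        (Finset.abs_sum_le_sum_abs _ _).trans
          (Finset.sum_le_sum fun i _ => Finset.abs_sum_le_sum_abs _ _)
    _ ≤ ∑ _i : Fin n₁, ∑ _j : Fin n₂, r₁ * r₂ * mixedGradNorm f z := by
        refine Finset.sum_le_sum fun i _ => Finset.sum_le_sum fun j _ => ?_
        rw [abs_mul, abs_mul]
        exact mul_le_mul (mul_le_mul (hu i) (hv j) (abs_nonneg _) hr₁) (abs_mixedPartial_le i j z)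
          (abs_nonneg _) (mul_nonneg hr₁ ((abs_nonneg _).trans (hv j)))
    _ = n₁ * n₂ * r₁ * r₂ * mixedGradNorm f z := by
        simp only [Finset.sum_const, Finset.card_univ, Fintype.card_fin, nsmul_eq_mul]; ring

lemma enorm_mixedDifference_le (hf : ContDiff ℝ 2 f) (z w : E n₁ × E n₂) {r₁ r₂ : ℝ}
    (hu : ∀ i, |(z.1 - w.1) i| ≤ r₁) (hv : ∀ j, |(z.2 - w.2) j| ≤ r₂)
    (hr₁ : 0 ≤ r₁) (hr₂ : 0 ≤ r₂) :
    ‖f z - f (w.1, z.2) - f (z.1, w.2) + f w‖ₑ ≤ ENNReal.ofReal (n₁ * n₂ * r₁ * r₂) *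
      ∫⁻ t in Icc (0 : ℝ) 1, ∫⁻ s in Icc (0 : ℝ) 1,
        ENNReal.ofReal (mixedGradNorm f (w.1 + s • (z.1 - w.1), w.2 + t • (z.2 - w.2))) := by
  obtain ⟨x, y⟩ := z
  obtain ⟨x', y'⟩ := w
  dsimp only at hu hv ⊢
  have hf' : ContDiff ℝ 1 (fderiv ℝ f) := hf.fderiv_right (m := 1) (by norm_num)
  have hf1 : ContDiff ℝ 1 f := hf.of_le (by norm_num)
  have hline : ∀ (a : E n₁) (t : ℝ), HasDerivAt (fun t : ℝ => (a, y' + t • (y - y')))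
      ((0 : E n₁), y - y') t := fun a t => by
    have := ((hasDerivAt_id t).smul_const (y - y')).const_add y'
    simpa using (hasDerivAt_const t a).prodMk this
  have hline' : ∀ (b : E n₂) (s : ℝ), HasDerivAt (fun s : ℝ => (x' + s • (x - x'), b))
      (x - x', (0 : E n₂)) s := fun b s => by
    have := ((hasDerivAt_id s).smul_const (x - x')).const_add x'
    simpa using this.prodMk (hasDerivAt_const s b)
  have hG : ∀ t : ℝ, deriv (fun t : ℝ => f (x, y' + t • (y - y')) - f (x', y' + t • (y - y'))) t =
      fderiv ℝ f (x, y' + t • (y - y')) (0, y - y') -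
        fderiv ℝ f (x', y' + t • (y - y')) (0, y - y') := fun t => by
    have h : ∀ a, HasDerivAt (fun t : ℝ => f (a, y' + t • (y - y')))
        (fderiv ℝ f (a, y' + t • (y - y')) (0, y - y')) t := fun a =>
      (hf1.differentiable (by norm_num) _).hasFDerivAt.comp_hasDerivAt t (hline a t)
    exact ((h x).sub (h x')).deriv
  have hK : ∀ t s : ℝ, deriv (fun s : ℝ => fderiv ℝ f (x' + s • (x - x'), y' + t • (y - y'))
      (0, y - y')) s = fderiv ℝ (fderiv ℝ f) (x' + s • (x - x'), y' + t • (y - y'))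
      (x - x', 0) (0, y - y') := fun t s => by
    have h : HasDerivAt (fun s : ℝ => fderiv ℝ f (x' + s • (x - x'), y' + t • (y - y')))
        (fderiv ℝ (fderiv ℝ f) (x' + s • (x - x'), y' + t • (y - y')) (x - x', 0)) s :=
      (hf'.differentiable (by norm_num) _).hasFDerivAt.comp_hasDerivAt s (hline' _ s)
    have := h.clm_apply (hasDerivAt_const s ((0 : E n₁), y - y'))
    simpa using this.deriv
  have hmeas := (continuous_mixedGradNorm hf).measurable.ennreal_ofReal
  calc ‖f (x, y) - f (x', y) - f (x, y') + f (x', y')‖ₑ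
      ≤ ∫⁻ t in Icc (0 : ℝ) 1,
        ‖deriv (fun t : ℝ => f (x, y' + t • (y - y')) - f (x', y' + t • (y - y'))) t‖ₑ := by
        have := enorm_sub_le_lintegral_deriv_of_contDiffOn_Icc (a := 0) (b := 1)
          (f := fun t : ℝ => f (x, y' + t • (y - y')) - f (x', y' + t • (y - y')))
          (ContDiff.contDiffOn (by fun_prop)) zero_le_one
        refine le_of_eq_of_le ?_ this
        congr 1
        simp
        ring
    _ ≤ ∫⁻ t in Icc (0 : ℝ) 1, ∫⁻ s in Icc (0 : ℝ) 1,
        ‖fderiv ℝ (fderiv ℝ f) (x' + s • (x - x'), y' + t • (y - y'))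
          (x - x', 0) (0, y - y')‖ₑ := by
        refine lintegral_mono fun t => ?_
        have := enorm_sub_le_lintegral_deriv_of_contDiffOn_Icc (a := 0) (b := 1)
          (f := fun s : ℝ => fderiv ℝ f (x' + s • (x - x'), y' + t • (y - y')) (0, y - y'))
          (ContDiff.contDiffOn (by fun_prop)) zero_le_one
        simp_rw [hK] at this
        rw [hG]
        simpa using this
    _ ≤ ∫⁻ t in Icc (0 : ℝ) 1, ∫⁻ s in Icc (0 : ℝ) 1, ENNReal.ofReal (n₁ * n₂ * r₁ * r₂) *
        ENNReal.ofReal (mixedGradNorm f (x' + s • (x - x'), y' + t • (y - y'))) := by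
        refine lintegral_mono fun t => lintegral_mono fun s => ?_
        rw [Real.enorm_eq_ofReal_abs, ← ENNReal.ofReal_mul (by positivity)]
        exact ENNReal.ofReal_le_ofReal (abs_fderiv_fderiv_le hf _ hu hv hr₁)
    _ = _ := by
        rw [← lintegral_const_mul]
        · refine lintegral_congr fun t => lintegral_const_mul _ ?_
          exact hmeas.comp (by fun_prop)
        · refine Measurable.lintegral_prod_right' (f := fun q : ℝ × ℝ => ENNReal.ofReal
            (mixedGradNorm f (x' + q.2 • (x - x'), y' + q.1 • (y - y')))) ?_
          exact hmeas.comp (by fun_prop)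

end Derivatives

section Cube

variable {m : ℕ} (a : E m) (r : ℝ)

lemma isCompact_cube : IsCompact (cube a r) := by
  have : cube a r = (EuclideanSpace.equiv (Fin m) ℝ).toHomeomorph ⁻¹'
      (Set.pi univ fun i => Icc (a i) (a i + r)) := by
    ext x; simp [cube, Pi.le_def, forall_and]
  rw [this, Homeomorph.isCompact_preimage]
  exact isCompact_univ_pi fun i => isCompact_Icc

lemma measurableSet_cube : MeasurableSet (cube a r) := (isCompact_cube a r).measurableSet

lemma convex_cube : Convex ℝ (cube a r) := by
  intro x hx y hy s t hs ht hst i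
  exact convex_Icc (a i) (a i + r) (hx i) (hy i) hs ht hst

variable {a r}

lemma abs_sub_le_of_mem_cube {x y : E m} (hx : x ∈ cube a r) (hy : y ∈ cube a r) (i : Fin m) :
    |(x - y) i| ≤ r := by
  have h1 := hx i
  have h2 := hy i
  simp only [mem_Icc] at h1 h2
  rw [PiLp.sub_apply, abs_le]
  constructor <;> linarith

end Cube

/-- Up to normalization, the deviation of `f` from `piR` is controlled by the mean of its mixed
differences. -/
lemma enorm_sub_piR_le {n₁ n₂ : ℕ} {a₁ : E n₁} {r₁ : ℝ} {a₂ : E n₂} {r₂ : ℝ}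
    {f : E n₁ × E n₂ → ℝ} (hf : Continuous f)
    (h0 : volume (rect a₁ r₁ a₂ r₂) ≠ 0) (z : E n₁ × E n₂) :
    ‖f z - piR a₁ r₁ a₂ r₂ f z‖ₑ ≤ (volume (rect a₁ r₁ a₂ r₂))⁻¹ *
      ∫⁻ w in rect a₁ r₁ a₂ r₂, ‖f z - f (w.1, z.2) - f (z.1, w.2) + f w‖ₑ := by
  have hc : IsCompact (rect a₁ r₁ a₂ r₂) := (isCompact_cube a₁ r₁).prod (isCompact_cube a₂ r₂)
  have hint : ∀ g : E n₁ × E n₂ → ℝ, Continuous g →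
      Integrable g (volume.restrict (rect a₁ r₁ a₂ r₂)) :=
    fun g hg => hg.continuousOn.integrableOn_compact hc
  have hv : volume (rect a₁ r₁ a₂ r₂) = volume (cube a₁ r₁) * volume (cube a₂ r₂) := by
    rw [rect, Measure.volume_eq_prod, Measure.prod_prod]
  have ht : volume (rect a₁ r₁ a₂ r₂) ≠ ∞ := hc.measure_lt_top.ne
  have hrr : volume.real (rect a₁ r₁ a₂ r₂) =
      volume.real (cube a₁ r₁) * volume.real (cube a₂ r₂) := by
    simp [measureReal_def, hv]
  have hpos : volume.real (rect a₁ r₁ a₂ r₂) ≠ 0 := by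
    simp [measureReal_def, ENNReal.toReal_eq_zero_iff, h0, ht]
  have hp := hrr ▸ hpos
  have hp1 := left_ne_zero_of_mul hp
  have hp2 := right_ne_zero_of_mul hp
  have hrestr : volume.restrict (rect a₁ r₁ a₂ r₂) =
      (volume.restrict (cube a₁ r₁)).prod (volume.restrict (cube a₂ r₂)) := by
    rw [Measure.prod_restrict]; rfl
  have e : f z - piR a₁ r₁ a₂ r₂ f z = (volume.real (rect a₁ r₁ a₂ r₂))⁻¹ *
      ∫ w in rect a₁ r₁ a₂ r₂, (f z - f (w.1, z.2) - f (z.1, w.2) + f w) := by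
    have h1 : ∫ w in rect a₁ r₁ a₂ r₂, f (w.1, z.2) =
        volume.real (cube a₂ r₂) * ∫ x in cube a₁ r₁, f (x, z.2) := by
      rw [hrestr, integral_fun_fst (fun x => f (x, z.2))]; simp [measureReal_def]
    have h2 : ∫ w in rect a₁ r₁ a₂ r₂, f (z.1, w.2) =
        volume.real (cube a₁ r₁) * ∫ y in cube a₂ r₂, f (z.1, y) := by
      rw [hrestr, integral_fun_snd (fun y => f (z.1, y))]; simp [measureReal_def]
    rw [integral_add (hint _ (by fun_prop)) (hint _ hf),
      integral_sub (hint _ (by fun_prop)) (hint _ (by fun_prop)),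
      integral_sub (hint _ (by fun_prop)) (hint _ (by fun_prop)), h1, h2, setIntegral_const, piR,
      setAverage_eq, setAverage_eq, setAverage_eq, hrr]
    simp only [smul_eq_mul]
    field_simp
    ring
  rw [e, enorm_mul]
  gcongr
  · rw [enorm_inv hpos, measureReal_def, Real.enorm_eq_ofReal ENNReal.toReal_nonneg,
      ENNReal.ofReal_toReal ht]
  · exact enorm_integral_le_lintegral_enorm _

/-- inequality (1.11) of the paper: for a rectangle `R = I₁ × I₂` that is a
product of two axis-parallel cubes and `f ∈ C²`,
`∫_R |f - π_R(f)| ≤ c ℓ(I₁) ℓ(I₂) ∫_R |∇ₓ∇_y f|` with `c = c(n₁,n₂)`. -/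
theorem unweighted_11_biparam_poincare (n₁ n₂ : ℕ) (hn₁ : 0 < n₁) (hn₂ : 0 < n₂) :
    ∃ c : ℝ, 0 < c ∧
      ∀ (a₁ : E n₁) (r₁ : ℝ) (a₂ : E n₂) (r₂ : ℝ), 0 < r₁ → 0 < r₂ →
        ∀ f : E n₁ × E n₂ → ℝ, ContDiff ℝ 2 f →
          (∫⁻ z in rect a₁ r₁ a₂ r₂, ENNReal.ofReal |f z - piR a₁ r₁ a₂ r₂ f z|)
            ≤ ENNReal.ofReal (c * r₁ * r₂) *
              ∫⁻ z in rect a₁ r₁ a₂ r₂, ENNReal.ofReal (mixedGradNorm f z) := by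
  refine ⟨n₁ * n₂ * 2 ^ (n₁ + n₂), by positivity, fun a₁ r₁ a₂ r₂ hr₁ hr₂ f hf => ?_⟩
  rcases eq_or_ne (volume (rect a₁ r₁ a₂ r₂)) 0 with h0 | h0
  · simp [Measure.restrict_eq_zero.2 h0]
  have ht : volume (rect a₁ r₁ a₂ r₂) ≠ ∞ :=
    ((isCompact_cube a₁ r₁).prod (isCompact_cube a₂ r₂)).measure_lt_top.ne
  have hR : MeasurableSet (rect a₁ r₁ a₂ r₂) :=
    (measurableSet_cube a₁ r₁).prod (measurableSet_cube a₂ r₂)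
  set R := rect a₁ r₁ a₂ r₂
  set K := ENNReal.ofReal (n₁ * n₂ * r₁ * r₂) with hK
  set h : E n₁ × E n₂ → ℝ≥0∞ := fun z => ENNReal.ofReal (mixedGradNorm f z)
  have hm : Measurable h := (continuous_mixedGradNorm hf).measurable.ennreal_ofReal
  let F (t s : ℝ) (z w : E n₁ × E n₂) : ℝ≥0∞ :=
    h (w.1 + s • (z.1 - w.1), w.2 + t • (z.2 - w.2))
  have hF : Measurable fun q : ((ℝ × ℝ) × E n₁ × E n₂) × E n₁ × E n₂ =>
      F q.1.1.1 q.1.1.2 q.1.2 q.2 := hm.comp (by fun_prop)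
  let ν : Measure (ℝ × ℝ) := (volume.restrict (Icc 0 1)).prod (volume.restrict (Icc 0 1))
  calc ∫⁻ z in R, ENNReal.ofReal |f z - piR a₁ r₁ a₂ r₂ f z|
      ≤ ∫⁻ z in R, (volume R)⁻¹ * ∫⁻ w in R, K * ∫⁻ p, F p.1 p.2 z w ∂ν := by
        refine setLIntegral_mono' hR fun z hz => ?_
        rw [← Real.enorm_eq_ofReal_abs]
        refine (enorm_sub_piR_le hf.continuous h0 z).trans ?_
        refine mul_le_mul_right ?_ _
        refine setLIntegral_mono' hR fun w hw => ?_
        refine (enorm_mixedDifference_le hf z w (abs_sub_le_of_mem_cube hz.1 hw.1)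
          (abs_sub_le_of_mem_cube hz.2 hw.2) hr₁.le hr₂.le).trans_eq ?_
        rw [lintegral_prod]
        exact (hm.comp (by fun_prop)).aemeasurable
    _ = (volume R)⁻¹ * K * ∫⁻ p, (∫⁻ z in R, ∫⁻ w in R, F p.1 p.2 z w) ∂ν := by
        have hFp : ∀ z, Measurable fun w => ∫⁻ p, F p.1 p.2 z w ∂ν := fun z =>
          Measurable.lintegral_prod_right'
            (f := fun q : (E n₁ × E n₂) × ℝ × ℝ => F q.2.1 q.2.2 z q.1) (hm.comp (by fun_prop))
        have hFw : Measurable fun z => ∫⁻ w in R, ∫⁻ p, F p.1 p.2 z w ∂ν :=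
          Measurable.lintegral_prod_right' (f := fun q : (E n₁ × E n₂) × E n₁ × E n₂ =>
            ∫⁻ p, F p.1 p.2 q.1 q.2 ∂ν) (Measurable.lintegral_prod_right'
            (f := fun q : ((E n₁ × E n₂) × E n₁ × E n₂) × ℝ × ℝ => F q.2.1 q.2.2 q.1.1 q.1.2)
            (hm.comp (by fun_prop)))
        simp_rw [fun z => lintegral_const_mul (μ := volume.restrict R) K (hFp z), ← mul_assoc]
        rw [lintegral_const_mul _ hFw]
        congr 1
        exact (lintegral_lintegral_lintegral_comm (F := fun p : ℝ × ℝ => F p.1 p.2) hF).symm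
    _ ≤ (volume R)⁻¹ * K * ∫⁻ _, (2 ^ (n₁ + n₂) * volume R * ∫⁻ z in R, h z) ∂ν := by
        refine mul_le_mul_right ?_ _
        have hν : ν = volume.restrict (Icc 0 1 ×ˢ Icc 0 1) := by
          rw [Measure.volume_eq_prod, ← Measure.prod_restrict]
        rw [hν]
        refine setLIntegral_mono' (measurableSet_Icc.prod measurableSet_Icc) fun p hp => ?_
        exact lintegral_rect_comp_convexComb_le hm (measurableSet_cube a₁ r₁) (convex_cube a₁ r₁)
          (measurableSet_cube a₂ r₂) (convex_cube a₂ r₂) hp.2.1 hp.2.2 hp.1.1 hp.1.2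
    _ = (volume R)⁻¹ * volume R * (K * 2 ^ (n₁ + n₂)) * ∫⁻ z in R, h z := by
        have hν : ν univ = 1 := by
          simp only [ν]
          rw [← univ_prod_univ, Measure.prod_prod]
          simp
        rw [lintegral_const, hν]
        ring
    _ = ENNReal.ofReal (n₁ * n₂ * 2 ^ (n₁ + n₂) * r₁ * r₂) * ∫⁻ z in R, h z := by
        rw [ENNReal.inv_mul_cancel h0 ht, one_mul, hK]
        congr 1
        rw [show (2 : ℝ≥0∞) ^ (n₁ + n₂) = ENNReal.ofReal (2 ^ (n₁ + n₂)) by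
          rw [ENNReal.ofReal_pow (by norm_num)]; simp, ← ENNReal.ofReal_mul (by positivity)]
        congr 1
        ring
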